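/- Let N ≥ 3, let U(x) := (N(N−2))^{(N−2)/4} (1 + |x|²)^{−(N−2)/2} be the standard Aubin–Talenti bubble on R^N, and for n ∈ ℕ set U_n(x) := n^{(N−2)/2} U(nx). Let η ∈ C_c^∞(B(0,1)) with 0 ≤ η ≤ 1 and η ≡ 1 on a neighborhood of 0, and put u_n := η U_n. Then, as n → ∞: (i) ∫_{B(0,1)} u_n^{2*} dx = ∫_{R^N} U^{2*} dx + O(n^{−N}), and (ii) ∫_{B(0,1)} |∇u_n|² dx = ∫_{R^N} |∇U|² dx + O(n^{−(N−2)}), where 2* = 2N/(N−2). -/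

import Mathlib

open MeasureTheory Metric Set Filter Asymptotics

noncomputable section

/-- Points of `ℝ^N`. -/
abbrev Pt (N : ℕ) := EuclideanSpace ℝ (Fin N)

/-- The critical Sobolev exponent `2* = 2N/(N-2)`. -/
def tstar (N : ℕ) : ℝ := 2 * N / ((N : ℝ) - 2)

/-- The standard Aubin–Talenti bubble `U(x) = (N(N-2))^{(N-2)/4} (1+|x|²)^{-(N-2)/2}`. -/
def bubbleU (N : ℕ) (x : Pt N) : ℝ :=
  ((N : ℝ) * ((N : ℝ) - 2)) ^ (((N : ℝ) - 2) / 4) *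
    (1 + ‖x‖ ^ 2) ^ (-(((N : ℝ) - 2) / 2))

/-- The concentration rescaling `U_n(x) = n^{(N-2)/2} U(nx)`. -/
def bubbleUn (N : ℕ) (n : ℕ) (x : Pt N) : ℝ :=
  (n : ℝ) ^ (((N : ℝ) - 2) / 2) * bubbleU N ((n : ℝ) • x)

/-- The amplitude `(N(N-2))^{(N-2)/4}` of the Aubin–Talenti bubble. -/
def bubbleConst (N : ℕ) : ℝ := ((N : ℝ) * ((N : ℝ) - 2)) ^ (((N : ℝ) - 2) / 4)

lemma bubbleU_eq (N : ℕ) (x : Pt N) :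
    bubbleU N x = bubbleConst N * (1 + ‖x‖ ^ 2) ^ (-(((N : ℝ) - 2) / 2)) := rfl

lemma two_lt_cast {N : ℕ} (hN : 3 ≤ N) : (2 : ℝ) < N := by exact_mod_cast hN

lemma bubbleConst_nonneg {N : ℕ} (hN : 3 ≤ N) : 0 ≤ bubbleConst N := by
  have := two_lt_cast hN
  exact Real.rpow_nonneg (mul_nonneg (by linarith) (by linarith)) _

lemma bubbleU_nonneg {N : ℕ} (hN : 3 ≤ N) (x : Pt N) : 0 ≤ bubbleU N x :=
  mul_nonneg (bubbleConst_nonneg hN) (Real.rpow_nonneg (by positivity) _)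

lemma bubbleUn_nonneg {N : ℕ} (hN : 3 ≤ N) (n : ℕ) (x : Pt N) : 0 ≤ bubbleUn N n x :=
  mul_nonneg (Real.rpow_nonneg (Nat.cast_nonneg n) _) (bubbleU_nonneg hN _)

lemma tstar_pos {N : ℕ} (hN : 3 ≤ N) : 0 < tstar N := by
  have := two_lt_cast hN
  exact div_pos (by linarith) (by linarith)

lemma contDiff_bubbleU (N : ℕ) : ContDiff ℝ 1 (bubbleU N) :=
  contDiff_const.mul <| ContDiff.rpow_const_of_ne (contDiff_const.add (contDiff_norm_sq ℝ))
    fun x => by positivity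

lemma contDiff_bubbleUn (N n : ℕ) : ContDiff ℝ 1 (bubbleUn N n) :=
  contDiff_const.mul ((contDiff_bubbleU N).comp (contDiff_const_smul _))

lemma bubbleU_rpow_tstar {N : ℕ} (hN : 3 ≤ N) (x : Pt N) :
    bubbleU N x ^ tstar N = bubbleConst N ^ tstar N * (1 + ‖x‖ ^ 2) ^ (-(N : ℝ)) := by
  have h2 : (N : ℝ) - 2 ≠ 0 := by linarith [two_lt_cast hN]
  rw [bubbleU_eq, Real.mul_rpow (bubbleConst_nonneg hN) (Real.rpow_nonneg (by positivity) _),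
    ← Real.rpow_mul (by positivity)]
  congr 2
  unfold tstar
  field_simp

lemma bubbleUn_rpow_tstar {N : ℕ} (hN : 3 ≤ N) (n : ℕ) (x : Pt N) :
    bubbleUn N n x ^ tstar N = (n : ℝ) ^ N * bubbleU N ((n : ℝ) • x) ^ tstar N := by
  have h2 : (N : ℝ) - 2 ≠ 0 := by linarith [two_lt_cast hN]
  rw [bubbleUn, Real.mul_rpow (Real.rpow_nonneg (Nat.cast_nonneg n) _) (bubbleU_nonneg hN _),
    ← Real.rpow_mul (Nat.cast_nonneg n), ← Real.rpow_natCast (n : ℝ) N]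
  congr 2
  unfold tstar
  field_simp

lemma bubbleU_sq (N : ℕ) (x : Pt N) :
    bubbleU N x ^ 2 = bubbleConst N ^ 2 * (1 + ‖x‖ ^ 2) ^ (-((N : ℝ) - 2)) := by
  rw [bubbleU_eq, mul_pow, ← Real.rpow_natCast (_ ^ _) 2, ← Real.rpow_mul (by positivity)]
  congr 2
  push_cast
  ring

lemma bubbleUn_sq (N n : ℕ) (x : Pt N) :
    bubbleUn N n x ^ 2 = (n : ℝ) ^ ((N : ℝ) - 2) * bubbleU N ((n : ℝ) • x) ^ 2 := by
  rw [bubbleUn, mul_pow, ← Real.rpow_natCast (_ ^ _) 2, ← Real.rpow_mul (Nat.cast_nonneg n)]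
  congr 2
  push_cast
  ring

lemma norm_fderiv_bubbleU_sq_le {N : ℕ} (x : Pt N) :
    ‖fderiv ℝ (bubbleU N) x‖ ^ 2 ≤
      (bubbleConst N * ((N : ℝ) - 2)) ^ 2 * (1 + ‖x‖ ^ 2) ^ (-((N : ℝ) - 1)) := by
  have hpos : 0 < 1 + ‖x‖ ^ 2 := by positivity
  have hder := ((((hasStrictFDerivAt_norm_sq x).hasFDerivAt.const_add 1).rpow_const
    (p := -(((N : ℝ) - 2) / 2)) (Or.inl hpos.ne')).const_mul (bubbleConst N)).fderiv
  change fderiv ℝ (bubbleU N) x = _ at hder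
  have hsq : ((1 + ‖x‖ ^ 2) ^ (-(((N : ℝ) - 2) / 2) - 1)) ^ 2 * (1 + ‖x‖ ^ 2)
      = (1 + ‖x‖ ^ 2) ^ (-((N : ℝ) - 1)) := by
    rw [← Real.rpow_natCast (_ ^ _) 2, ← Real.rpow_mul hpos.le, ← Real.rpow_add_one hpos.ne']
    congr 1
    push_cast
    ring
  have hnorm : ‖fderiv ℝ (bubbleU N) x‖ ^ 2 = (bubbleConst N * ((N : ℝ) - 2)) ^ 2 *
      (((1 + ‖x‖ ^ 2) ^ (-(((N : ℝ) - 2) / 2) - 1)) ^ 2 * ‖x‖ ^ 2) := by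
    rw [hder, ← Nat.cast_smul_eq_nsmul ℝ, norm_smul, norm_smul, norm_smul, innerSL_apply_norm]
    simp only [mul_pow, Real.norm_eq_abs, sq_abs, abs_mul]
    push_cast
    ring
  rw [hnorm, ← hsq]
  gcongr
  linarith

lemma norm_fderiv_bubbleUn_sq {N n : ℕ} (hn : 0 < n) (x : Pt N) :
    ‖fderiv ℝ (bubbleUn N n) x‖ ^ 2 =
      (n : ℝ) ^ N * ‖fderiv ℝ (bubbleU N) ((n : ℝ) • x)‖ ^ 2 := by
  have hn' : (0 : ℝ) < n := by exact_mod_cast hn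
  have hder : fderiv ℝ (bubbleUn N n) x =
      (n : ℝ) ^ (((N : ℝ) - 2) / 2) • (n : ℝ) • fderiv ℝ (bubbleU N) ((n : ℝ) • x) := by
    rw [← fderiv_comp_smul, ← fderiv_const_smul]
    · rfl
    · exact ((contDiff_bubbleU N).comp (contDiff_const_smul _)).differentiable one_ne_zero _
  rw [hder, norm_smul, norm_smul, mul_pow, mul_pow, ← mul_assoc]
  congr 1
  simp only [Real.norm_eq_abs, sq_abs]
  rw [← Real.rpow_natCast (_ ^ _) 2, ← Real.rpow_mul hn'.le, ← Real.rpow_natCast (n : ℝ) 2,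
    ← Real.rpow_add hn', ← Real.rpow_natCast (n : ℝ) N]
  congr 1
  push_cast
  ring

lemma one_add_norm_smul_sq_rpow_le {N n : ℕ} (hn : 0 < n) {δ s : ℝ} (hδ : 0 < δ) (hs : 0 ≤ s)
    {x : Pt N} (hx : δ ≤ ‖x‖) :
    (1 + ‖(n : ℝ) • x‖ ^ 2) ^ (-s) ≤
      (δ ^ 2 / (1 + δ ^ 2)) ^ (-s) * (n : ℝ) ^ (-(2 * s)) * (1 + ‖x‖ ^ 2) ^ (-s) := by
  have hn' : (0 : ℝ) < n := by exact_mod_cast hn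
  have hx2 : δ ^ 2 ≤ ‖x‖ ^ 2 := by gcongr
  have hκ : δ ^ 2 / (1 + δ ^ 2) * (1 + ‖x‖ ^ 2) ≤ ‖x‖ ^ 2 := by
    rw [div_mul_eq_mul_div, div_le_iff₀ (by positivity)]
    nlinarith
  have hle : δ ^ 2 / (1 + δ ^ 2) * (n : ℝ) ^ 2 * (1 + ‖x‖ ^ 2) ≤ 1 + ‖(n : ℝ) • x‖ ^ 2 := by
    rw [norm_smul, mul_pow, Real.norm_eq_abs, sq_abs]
    nlinarith [mul_le_mul_of_nonneg_left hκ (sq_nonneg (n : ℝ))]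
  refine (Real.rpow_le_rpow_of_nonpos (by positivity) hle (neg_nonpos.2 hs)).trans_eq ?_
  rw [Real.mul_rpow (by positivity) (by positivity), Real.mul_rpow (by positivity) (by positivity),
    ← Real.rpow_natCast (n : ℝ) 2, ← Real.rpow_mul hn'.le]
  congr 3
  push_cast
  ring

lemma integrable_one_add_norm_sq_rpow {N : ℕ} {s : ℝ} (hs : (N : ℝ) < 2 * s) :
    Integrable (fun x : Pt N => (1 + ‖x‖ ^ 2) ^ (-s)) := by
  have h := integrable_rpow_neg_one_add_norm_sq (E := Pt N) (μ := volume) (r := 2 * s) (by simpa)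
  refine h.congr (Eventually.of_forall fun x => ?_)
  simp only
  congr 1
  ring

/-- If `F n` agrees with the mass-preserving rescaling `n^N G(n x)` up to `C n^{-a} g`, with `g`
integrable, then the integrals of `F n` and `G` agree up to `O(n^{-a})`. -/
lemma isBigO_integral_sub_of_rescaling {N : ℕ} {F : ℕ → Pt N → ℝ} {G g : Pt N → ℝ} {a C : ℝ}
    (hF : ∀ n, AEStronglyMeasurable (F n)) (hG : Integrable G) (hg : Integrable g)
    (hb : ∀ n : ℕ, 0 < n → ∀ x,
      |F n x - (n : ℝ) ^ N * G ((n : ℝ) • x)| ≤ C * (n : ℝ) ^ (-a) * g x) :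
    (fun n : ℕ => (∫ x, F n x) - ∫ x, G x) =O[atTop] fun n : ℕ => (n : ℝ) ^ (-a) := by
  refine IsBigO.of_bound (C * ∫ x, g x) ?_
  filter_upwards [eventually_gt_atTop 0] with n hn
  have hn' : (0 : ℝ) < n := by exact_mod_cast hn
  have hGn : Integrable fun x : Pt N => (n : ℝ) ^ N * G ((n : ℝ) • x) :=
    (hG.comp_smul hn'.ne').const_mul _
  have hdom : Integrable fun x => C * (n : ℝ) ^ (-a) * g x := hg.const_mul _
  have hdiff : Integrable fun x => F n x - (n : ℝ) ^ N * G ((n : ℝ) • x) :=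
    hdom.mono' ((hF n).sub hGn.aestronglyMeasurable) (Eventually.of_forall (hb n hn))
  have hscale : ∫ x, (n : ℝ) ^ N * G ((n : ℝ) • x) = ∫ x, G x := by
    rw [integral_const_mul, Measure.integral_comp_smul, finrank_euclideanSpace_fin,
      abs_of_pos (by positivity), smul_eq_mul, mul_inv_cancel_left₀ (by positivity)]
  have hFn : Integrable (F n) := by
    refine (hdiff.add hGn).congr (Eventually.of_forall fun x => ?_)
    simp
  rw [← hscale, ← integral_sub hFn hGn, Real.norm_of_nonneg (Real.rpow_nonneg hn'.le _)]
  refine (norm_integral_le_of_norm_le hdom (Eventually.of_forall (hb n hn))).trans_eq ?_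
  rw [integral_const_mul]
  ring

lemma isBigO_integral_cutoff_rpow {N : ℕ} (hN : 3 ≤ N) {η : Pt N → ℝ} (hη : Continuous η)
    (h01 : ∀ x, η x ∈ Icc (0 : ℝ) 1) (hone : ∀ᶠ x in nhds (0 : Pt N), η x = 1) :
    (fun n : ℕ => (∫ x, (η x * bubbleUn N n x) ^ tstar N) - ∫ x : Pt N, bubbleU N x ^ tstar N)
      =O[atTop] fun n : ℕ => (n : ℝ) ^ (-(N : ℝ)) := by
  have hN2 := two_lt_cast hN
  obtain ⟨δ, hδ, hball⟩ := Metric.eventually_nhds_iff.1 hone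
  have hg : Integrable (fun x : Pt N => (1 + ‖x‖ ^ 2) ^ (-(N : ℝ))) :=
    integrable_one_add_norm_sq_rpow (by linarith)
  have hc : 0 ≤ bubbleConst N ^ tstar N := Real.rpow_nonneg (bubbleConst_nonneg hN) _
  refine isBigO_integral_sub_of_rescaling (g := fun x => (1 + ‖x‖ ^ 2) ^ (-(N : ℝ)))
    (C := bubbleConst N ^ tstar N * (δ ^ 2 / (1 + δ ^ 2)) ^ (-(N : ℝ))) (fun n => ?_) ?_ hg ?_
  · exact ((hη.mul (contDiff_bubbleUn N n).continuous).rpow_const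
      fun _ => Or.inr (tstar_pos hN).le).aestronglyMeasurable
  · simp only [bubbleU_rpow_tstar hN]
    exact hg.const_mul _
  · intro n hn x
    have hn' : (0 : ℝ) < n := by exact_mod_cast hn
    rw [Real.mul_rpow (h01 x).1 (bubbleUn_nonneg hN n x), ← bubbleUn_rpow_tstar hN]
    rcases lt_or_ge ‖x‖ δ with hx | hx
    · rw [hball (by simpa using hx)]
      simp only [Real.one_rpow, one_mul, sub_self, abs_zero]
      positivity
    · have hη0 : 0 ≤ η x ^ tstar N := Real.rpow_nonneg (h01 x).1 _
      have hη1 : η x ^ tstar N ≤ 1 := Real.rpow_le_one (h01 x).1 (h01 x).2 (tstar_pos hN).le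
      have hU0 : 0 ≤ bubbleUn N n x ^ tstar N := Real.rpow_nonneg (bubbleUn_nonneg hN n x) _
      calc |η x ^ tstar N * bubbleUn N n x ^ tstar N - bubbleUn N n x ^ tstar N|
          ≤ bubbleUn N n x ^ tstar N := abs_le.2 ⟨by nlinarith, by nlinarith⟩
        _ = bubbleConst N ^ tstar N *
            ((n : ℝ) ^ N * (1 + ‖(n : ℝ) • x‖ ^ 2) ^ (-(N : ℝ))) := by
          rw [bubbleUn_rpow_tstar hN, bubbleU_rpow_tstar hN]
          ring
        _ ≤ bubbleConst N ^ tstar N * ((n : ℝ) ^ N * ((δ ^ 2 / (1 + δ ^ 2)) ^ (-(N : ℝ)) *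
            (n : ℝ) ^ (-(2 * (N : ℝ))) * (1 + ‖x‖ ^ 2) ^ (-(N : ℝ)))) := by
          gcongr
          exact one_add_norm_smul_sq_rpow_le hn hδ (by linarith) hx
        _ = _ := by
          have hpow : (n : ℝ) ^ N * (n : ℝ) ^ (-(2 * (N : ℝ))) = (n : ℝ) ^ (-(N : ℝ)) := by
            rw [← Real.rpow_natCast (n : ℝ) N, ← Real.rpow_add hn']
            congr 1
            ring
          rw [← hpow]
          ring

lemma isBigO_integral_cutoff_fderiv {N : ℕ} (hN : 3 ≤ N) {η : Pt N → ℝ} (hη : ContDiff ℝ 1 η)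
    (hsupp : HasCompactSupport η) (h01 : ∀ x, η x ∈ Icc (0 : ℝ) 1)
    (hone : ∀ᶠ x in nhds (0 : Pt N), η x = 1) :
    (fun n : ℕ => (∫ x, ‖fderiv ℝ (fun y => η y * bubbleUn N n y) x‖ ^ 2)
        - ∫ x : Pt N, ‖fderiv ℝ (bubbleU N) x‖ ^ 2)
      =O[atTop] fun n : ℕ => (n : ℝ) ^ (-((N : ℝ) - 2)) := by
  have hN2 := two_lt_cast hN
  obtain ⟨δ, hδ, hball⟩ := Metric.eventually_nhds_iff_ball.1 hone
  have hg : Integrable (fun x : Pt N => (1 + ‖x‖ ^ 2) ^ (-((N : ℝ) - 1))) :=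
    integrable_one_add_norm_sq_rpow (by linarith)
  obtain ⟨M, hM⟩ : ∃ M, ∀ x, ‖‖fderiv ℝ η x‖ ^ 2 * (1 + ‖x‖ ^ 2)‖ ≤ M := by
    refine HasCompactSupport.exists_bound_of_continuous ?_ ?_
    · exact ((hsupp.fderiv ℝ).norm.comp_left (g := fun t : ℝ => t ^ 2) (by simp)).mul_right
    · exact ((hη.continuous_fderiv one_ne_zero).norm.pow 2).mul (by fun_prop)
  have hM0 : 0 ≤ M := (norm_nonneg _).trans (hM 0)
  set κ : ℝ := δ ^ 2 / (1 + δ ^ 2)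
  have hκ0 : 0 < κ := by positivity
  set A : ℝ := (bubbleConst N * ((N : ℝ) - 2)) ^ 2
  refine isBigO_integral_sub_of_rescaling (g := fun x => (1 + ‖x‖ ^ 2) ^ (-((N : ℝ) - 1)))
    (C := 3 * (A * κ ^ (-((N : ℝ) - 1))) + 2 * (bubbleConst N ^ 2 * κ ^ (-((N : ℝ) - 2)) * M))
    (fun n => ?_) ?_ hg ?_
  · exact (((hη.mul (contDiff_bubbleUn N n)).continuous_fderiv one_ne_zero).norm.pow
      2).aestronglyMeasurable
  · refine (hg.const_mul A).mono' (((contDiff_bubbleU N).continuous_fderiv one_ne_zero).norm.pow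
      2).aestronglyMeasurable (Eventually.of_forall fun x => ?_)
    rw [Real.norm_of_nonneg (by positivity)]
    exact norm_fderiv_bubbleU_sq_le x
  · intro n hn x
    have hn' : (0 : ℝ) < n := by exact_mod_cast hn
    rw [← norm_fderiv_bubbleUn_sq hn]
    rcases lt_or_ge ‖x‖ δ with hx | hx
    · have hloc : (fun y => η y * bubbleUn N n y) =ᶠ[nhds x] bubbleUn N n := by
        filter_upwards [isOpen_ball.mem_nhds (mem_ball_zero_iff.2 hx)] with y hy
        rw [hball y hy, one_mul]
      rw [hloc.fderiv_eq, sub_self, abs_zero]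
      positivity
    · have hgrad : ‖fderiv ℝ (bubbleUn N n) x‖ ^ 2 ≤
          A * κ ^ (-((N : ℝ) - 1)) * (n : ℝ) ^ (-((N : ℝ) - 2)) *
            (1 + ‖x‖ ^ 2) ^ (-((N : ℝ) - 1)) := by
        calc ‖fderiv ℝ (bubbleUn N n) x‖ ^ 2
            = (n : ℝ) ^ N * ‖fderiv ℝ (bubbleU N) ((n : ℝ) • x)‖ ^ 2 :=
              norm_fderiv_bubbleUn_sq hn x
          _ ≤ (n : ℝ) ^ N * (A * (κ ^ (-((N : ℝ) - 1)) * (n : ℝ) ^ (-(2 * ((N : ℝ) - 1))) *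
              (1 + ‖x‖ ^ 2) ^ (-((N : ℝ) - 1)))) := by
            gcongr
            refine (norm_fderiv_bubbleU_sq_le _).trans ?_
            gcongr
            exact one_add_norm_smul_sq_rpow_le hn hδ (by linarith) hx
          _ = _ := by
            have hpow : (n : ℝ) ^ N * (n : ℝ) ^ (-(2 * ((N : ℝ) - 1))) =
                (n : ℝ) ^ (-((N : ℝ) - 2)) := by
              rw [← Real.rpow_natCast (n : ℝ) N, ← Real.rpow_add hn']
              congr 1
              ring
            rw [← hpow]
            ring
      have hval : bubbleUn N n x ^ 2 * ‖fderiv ℝ η x‖ ^ 2 ≤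
          bubbleConst N ^ 2 * κ ^ (-((N : ℝ) - 2)) * M * (n : ℝ) ^ (-((N : ℝ) - 2)) *
            (1 + ‖x‖ ^ 2) ^ (-((N : ℝ) - 1)) := by
        calc bubbleUn N n x ^ 2 * ‖fderiv ℝ η x‖ ^ 2
            ≤ (n : ℝ) ^ ((N : ℝ) - 2) * (bubbleConst N ^ 2 * (κ ^ (-((N : ℝ) - 2)) *
              (n : ℝ) ^ (-(2 * ((N : ℝ) - 2))) * (1 + ‖x‖ ^ 2) ^ (-((N : ℝ) - 2)))) *
              ‖fderiv ℝ η x‖ ^ 2 := by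
              rw [bubbleUn_sq, bubbleU_sq]
              gcongr
              exact one_add_norm_smul_sq_rpow_le hn hδ (by linarith) hx
          _ = bubbleConst N ^ 2 * κ ^ (-((N : ℝ) - 2)) * (n : ℝ) ^ (-((N : ℝ) - 2)) *
              (1 + ‖x‖ ^ 2) ^ (-((N : ℝ) - 1)) * (‖fderiv ℝ η x‖ ^ 2 * (1 + ‖x‖ ^ 2)) := by
            have hpow : (n : ℝ) ^ ((N : ℝ) - 2) * (n : ℝ) ^ (-(2 * ((N : ℝ) - 2))) =
                (n : ℝ) ^ (-((N : ℝ) - 2)) := by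
              rw [← Real.rpow_add hn']
              congr 1
              ring
            have hbr : (1 + ‖x‖ ^ 2) ^ (-((N : ℝ) - 2)) =
                (1 + ‖x‖ ^ 2) ^ (-((N : ℝ) - 1)) * (1 + ‖x‖ ^ 2) := by
              rw [← Real.rpow_add_one (by positivity)]
              congr 1
              ring
            rw [← hpow, hbr]
            ring
          _ ≤ bubbleConst N ^ 2 * κ ^ (-((N : ℝ) - 2)) * (n : ℝ) ^ (-((N : ℝ) - 2)) *
              (1 + ‖x‖ ^ 2) ^ (-((N : ℝ) - 1)) * M := by
            gcongr
            exact (le_abs_self _).trans (hM x)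
          _ = _ := by ring
      have hprod : ‖fderiv ℝ (fun y => η y * bubbleUn N n y) x‖ ≤
          ‖fderiv ℝ (bubbleUn N n) x‖ + bubbleUn N n x * ‖fderiv ℝ η x‖ := by
        rw [fderiv_fun_mul (hη.differentiable one_ne_zero x)
          ((contDiff_bubbleUn N n).differentiable one_ne_zero x)]
        refine (norm_add_le _ _).trans ?_
        rw [norm_smul, norm_smul, Real.norm_of_nonneg (h01 x).1,
          Real.norm_of_nonneg (bubbleUn_nonneg hN n x)]
        gcongr
        exact mul_le_of_le_one_left (norm_nonneg _) (h01 x).2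
      have hprod_sq : ‖fderiv ℝ (fun y => η y * bubbleUn N n y) x‖ ^ 2 ≤
          2 * (‖fderiv ℝ (bubbleUn N n) x‖ ^ 2 + bubbleUn N n x ^ 2 * ‖fderiv ℝ η x‖ ^ 2) := by
        rw [← mul_pow]
        exact (pow_le_pow_left₀ (norm_nonneg _) hprod 2).trans add_sq_le
      have h0 := sq_nonneg ‖fderiv ℝ (fun y => η y * bubbleUn N n y) x‖
      have h1 := sq_nonneg ‖fderiv ℝ (bubbleUn N n) x‖
      have h2 : 0 ≤ bubbleUn N n x ^ 2 * ‖fderiv ℝ η x‖ ^ 2 := by positivity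
      refine abs_le.2 ⟨?_, ?_⟩ <;> linarith

lemma norm_gradient_eq_norm_fderiv {N : ℕ} (f : Pt N → ℝ) (x : Pt N) :
    ‖gradient f x‖ = ‖fderiv ℝ f x‖ := by
  simp [gradient]

/-- for `u_n = η U_n` with `η` a smooth cutoff supported in the unit ball
and `≡ 1` near `0`, as `n → ∞`:
(i) `∫_{B(0,1)} u_n^{2*} = ∫_{ℝ^N} U^{2*} + O(n^{-N})`, and
(ii) `∫_{B(0,1)} |∇u_n|² = ∫_{ℝ^N} |∇U|² + O(n^{-(N-2)})`. -/
theorem statement19 (N : ℕ) (hN : 3 ≤ N) (η : Pt N → ℝ)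
    (hη : ContDiff ℝ (⊤ : ℕ∞) η) (hsupp : HasCompactSupport η)
    (hsub : tsupport η ⊆ Metric.ball (0 : Pt N) 1)
    (h01 : ∀ x, η x ∈ Icc (0 : ℝ) 1)
    (hone : ∀ᶠ x in nhds (0 : Pt N), η x = 1) :
    ((fun n : ℕ =>
        (∫ x in Metric.ball (0 : Pt N) 1, (η x * bubbleUn N n x) ^ tstar N)
          - ∫ x : Pt N, bubbleU N x ^ tstar N)
      =O[atTop] fun n : ℕ => (n : ℝ) ^ (-(N : ℝ))) ∧
    ((fun n : ℕ =>
        (∫ x in Metric.ball (0 : Pt N) 1,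
          ‖gradient (fun y => η y * bubbleUn N n y) x‖ ^ 2)
          - ∫ x : Pt N, ‖gradient (bubbleU N) x‖ ^ 2)
      =O[atTop] fun n : ℕ => (n : ℝ) ^ (-((N : ℝ) - 2))) := by
  have hzero : ∀ x ∉ Metric.ball (0 : Pt N) 1, x ∉ tsupport η := fun x hx h => hx (hsub h)
  constructor
  · refine (isBigO_integral_cutoff_rpow hN hη.continuous h01 hone).congr_left fun n => ?_
    rw [setIntegral_eq_integral_of_forall_compl_eq_zero]
    intro x hx
    rw [image_eq_zero_of_notMem_tsupport (hzero x hx), zero_mul,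
      Real.zero_rpow (tstar_pos hN).ne']
  · simp only [norm_gradient_eq_norm_fderiv]
    refine (isBigO_integral_cutoff_fderiv hN (hη.of_le (by exact_mod_cast le_top)) hsupp h01
      hone).congr_left fun n => ?_
    rw [setIntegral_eq_integral_of_forall_compl_eq_zero]
    intro x hx
    have hnot : x ∉ tsupport fun y => η y * bubbleUn N n y := fun h =>
      hzero x hx (tsupport_mul_subset_left h)
    rw [fderiv_of_notMem_tsupport ℝ hnot, norm_zero, zero_pow two_ne_zero]
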